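/- Let D = D¹ # CG as above and let R be a Noetherian simple commutative D-module algebra on which each g ∈ G acts injectively. Then the following are equivalent: (1) R is total (every non-zero-divisor is invertible); (2) R/P is a field for every minimal prime P; (3) the Krull dimension of R is zero; (4) R is Artinian as a ring. In this case every R-module is projective. -/

import Mathlib

open TensorProduct

section Defs

variable (C D : Type*) [CommRing C] [Ring D] [Bialgebra C D]

/-- The convolution product on `Hom_C(D, A)`. -/
noncomputable def conv {A : Type*} [Ring A] [Algebra C A] (f g : D →ₗ[C] A) : D →ₗ[C] A :=
  LinearMap.mul' C A ∘ₗ TensorProduct.map f g ∘ₗ Coalgebra.comul (R := C)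

variable (A : Type*) [Ring A] [Algebra C A]

/-- A `D`-module algebra structure on a `C`-algebra `A`. -/
structure ModuleAlgebraStructure where
  act : D →ₗ[C] A →ₗ[C] A
  act_one : act 1 = LinearMap.id
  act_mul : ∀ d e : D, act (d * e) = act d ∘ₗ act e
  measure_mul : ∀ (d : D) (a b : A),
    act d (a * b) = conv C D (act.flip a) (act.flip b) d
  measure_one : ∀ d : D, act d 1 = Coalgebra.counit (R := C) d • (1 : A)

end Defs

section Coalgebra

variable {C : Type*} [Field C]

lemma TensorProduct.ext_of_dual_left {M N : Type*} [AddCommGroup M] [Module C M]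
    [AddCommGroup N] [Module C N] {z w : M ⊗[C] N}
    (h : ∀ f : M →ₗ[C] C, TensorProduct.lid C N (f.rTensor N z) =
      TensorProduct.lid C N (f.rTensor N w)) : z = w := by
  classical
  apply (equivFinsuppOfBasisLeft (N := N) (Module.Basis.ofVectorSpace C M)).injective
  ext i
  simpa only [equivFinsuppOfBasisLeft_apply] using h _

lemma TensorProduct.lid_rTensor_lTensor {M N P : Type*} [AddCommGroup M] [Module C M]
    [AddCommGroup N] [Module C N] [AddCommGroup P] [Module C P] (f : M →ₗ[C] C)
    (q : N →ₗ[C] P) (z : M ⊗[C] N) :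
    TensorProduct.lid C P (f.rTensor P (q.lTensor M z)) =
      q (TensorProduct.lid C N (f.rTensor N z)) := by
  induction z with
  | zero => simp
  | tmul x y => simp
  | add x y hx hy => simp [hx, hy]

variable {H : Type*} [AddCommGroup H] [Module C H] [Coalgebra C H]

/-- The action `d ↦ ∑ f(d₁) d₂` of a linear functional `f` on a coalgebra. -/
noncomputable def functionalAct (f : H →ₗ[C] C) : H →ₗ[C] H :=
  (TensorProduct.lid C H).toLinearMap ∘ₗ f.rTensor H ∘ₗ Coalgebra.comul (R := C)

lemma functionalAct_apply (f : H →ₗ[C] C) (d : H) : functionalAct f d =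
    TensorProduct.lid C H (f.rTensor H (Coalgebra.comul (R := C) d)) := rfl

lemma functionalAct_counit (d : H) :
    functionalAct (Coalgebra.counit (R := C)) d = d := by
  simp [functionalAct_apply, Coalgebra.rTensor_counit_comul]

lemma functionalAct_add (f g : H →ₗ[C] C) (d : H) :
    functionalAct (f + g) d = functionalAct f d + functionalAct g d := by
  simp [functionalAct_apply, LinearMap.rTensor_add]

lemma functionalAct_smul (c : C) (f : H →ₗ[C] C) (d : H) :
    functionalAct (c • f) d = c • functionalAct f d := by
  simp [functionalAct_apply, LinearMap.rTensor_smul]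

/-- The convolution product of two functionals. -/
noncomputable def functionalMul (f g : H →ₗ[C] C) : H →ₗ[C] C :=
  LinearMap.mul' C C ∘ₗ TensorProduct.map f g ∘ₗ Coalgebra.comul (R := C)

lemma functionalAct_functionalAct (f g : H →ₗ[C] C) (d : H) :
    functionalAct f (functionalAct g d) = functionalAct (functionalMul g f) d := by
  have h1 : ∀ z : H ⊗[C] H, functionalAct f (TensorProduct.lid C H (g.rTensor H z)) =
      TensorProduct.lid C H ((LinearMap.mul' C C).rTensor H ((TensorProduct.map g f).rTensor H
        ((TensorProduct.assoc C H H H).symm ((Coalgebra.comul (R := C)).lTensor H z)))) := by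
    intro z
    induction z with
    | zero => simp
    | add x y hx hy => simp [hx, hy]
    | tmul x y =>
      simp only [LinearMap.rTensor_tmul, LinearMap.lTensor_tmul, lid_tmul, map_smul,
        functionalAct_apply]
      induction Coalgebra.comul (R := C) y with
      | zero => simp
      | add u v hu hv => simp only [tmul_add, map_add, smul_add, hu, hv]
      | tmul u v => simp [mul_smul]
  rw [functionalAct_apply g, h1, ← Coalgebra.coassoc_apply, LinearEquiv.symm_apply_apply,
    functionalAct_apply, functionalMul]
  simp only [LinearMap.rTensor_comp, LinearMap.comp_apply]

lemma functionalMul_comm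
    (hcocomm : (TensorProduct.comm C H H).toLinearMap ∘ₗ Coalgebra.comul (R := C) =
      Coalgebra.comul (R := C)) (f g : H →ₗ[C] C) :
    functionalMul f g = functionalMul g f := by
  rw [functionalMul, functionalMul]
  nth_rewrite 1 [← hcocomm]
  simp only [← LinearMap.comp_assoc]
  congr 1
  ext x y
  simp [mul_comm]

lemma comul_mem_range_map_subtype_of_stable
    (hcocomm : (TensorProduct.comm C H H).toLinearMap ∘ₗ Coalgebra.comul (R := C) =
      Coalgebra.comul (R := C)) (S : Submodule C H)
    (hS : ∀ f : H →ₗ[C] C, ∀ s ∈ S, functionalAct f s ∈ S) (s : H) (hs : s ∈ S) :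
    Coalgebra.comul (R := C) s ∈ LinearMap.range (TensorProduct.map S.subtype S.subtype) := by
  obtain ⟨p, hp⟩ := S.subtype.exists_leftInverse_of_injective S.ker_subtype
  have hpS : ∀ x ∈ S, S.subtype (p x) = x := fun x hx ↦
    congrArg Subtype.val (LinearMap.congr_fun hp ⟨x, hx⟩)
  have hc : TensorProduct.comm C H H (Coalgebra.comul (R := C) s) =
      Coalgebra.comul (R := C) s := LinearMap.congr_fun hcocomm s
  have hl : (S.subtype ∘ₗ p).lTensor H (Coalgebra.comul (R := C) s) =
      Coalgebra.comul (R := C) s := by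
    refine TensorProduct.ext_of_dual_left fun f ↦ ?_
    rw [TensorProduct.lid_rTensor_lTensor]
    exact hpS _ (hS f s hs)
  have hr : (S.subtype ∘ₗ p).rTensor H (Coalgebra.comul (R := C) s) =
      Coalgebra.comul (R := C) s := by
    rw [← LinearMap.comm_comp_lTensor_comp_comm_eq]
    simp only [LinearMap.comp_apply, LinearEquiv.coe_coe]
    rw [hc, hl, hc]
  refine ⟨TensorProduct.map p p (Coalgebra.comul (R := C) s), ?_⟩
  rw [← LinearMap.comp_apply, ← TensorProduct.map_comp]
  conv_rhs => rw [← hr]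
  nth_rewrite 2 [← hl]
  rw [← LinearMap.comp_apply (LinearMap.rTensor _ _), LinearMap.rTensor_comp_lTensor]

/-- The orbit of `d` under all linear functionals. -/
noncomputable def functionalOrbit (d : H) : Submodule C H :=
  LinearMap.range ({ toFun := fun f ↦ functionalAct f d
                     map_add' := fun f g ↦ functionalAct_add f g d
                     map_smul' := fun c f ↦ functionalAct_smul c f d } :
    (H →ₗ[C] C) →ₗ[C] H)

lemma finiteDimensional_functionalOrbit (d : H) :
    FiniteDimensional C (functionalOrbit (C := C) d) := by
  obtain ⟨S, hS⟩ := TensorProduct.exists_finset (Coalgebra.comul (R := C) d)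
  classical
  refine Submodule.finiteDimensional_of_le
    (S₂ := Submodule.span C (S.image Prod.snd : Finset H)) ?_
  rintro _ ⟨f, rfl⟩
  change functionalAct f d ∈ _
  rw [functionalAct_apply, hS, map_sum, map_sum]
  refine Submodule.sum_mem _ fun i hi ↦ ?_
  simp only [LinearMap.rTensor_tmul, lid_tmul]
  exact Submodule.smul_mem _ _ (Submodule.subset_span (by
    simpa using ⟨i.1, hi⟩))

end Coalgebra

/-- In a pointed irreducible cocommutative bialgebra, a subspace `W` is everything as soon as it
contains each `d` whose images under functionals vanishing at `1` all lie in `W`. -/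
lemma irreducible_induction {C H : Type*} [Field C] [Ring H] [Bialgebra C H]
    (hcocomm : (TensorProduct.comm C H H).toLinearMap ∘ₗ Coalgebra.comul (R := C) =
      Coalgebra.comul (R := C))
    (hirr : ∀ S : Submodule C H, S ≠ ⊥ →
      (∀ s ∈ S, Coalgebra.comul (R := C) s ∈
        LinearMap.range (TensorProduct.map S.subtype S.subtype)) → (1 : H) ∈ S)
    (W : Submodule C H)
    (hW : ∀ d : H, (∀ f : H →ₗ[C] C, f 1 = 0 → functionalAct f d ∈ W) → d ∈ W) :
    W = ⊤ := by
  have key : ∀ n : ℕ, ∀ T : Submodule C H, FiniteDimensional C T → Module.finrank C T = n →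
      (∀ f : H →ₗ[C] C, ∀ t ∈ T, functionalAct f t ∈ T) → T ≤ W := by
    intro n
    induction n using Nat.strong_induction_on with
    | _ n ih =>
      intro T hfin hn hT
      by_cases hbot : T = ⊥
      · simp [hbot]
      have h1 : (1 : H) ∈ T :=
        hirr T hbot (comul_mem_range_map_subtype_of_stable hcocomm T hT)
      refine fun d hd ↦ hW d fun f hf ↦ ?_
      have hle : T.map (functionalAct f) ≤ T := by
        rintro _ ⟨t, ht, rfl⟩
        exact hT f t ht
      have hlt : Module.finrank C (T.map (functionalAct f)) < n := by
        rw [← hn]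
        by_contra! hcon
        let φ : T →ₗ[C] T := (functionalAct f).restrict (hT f)
        have hsurj : Function.Surjective φ := by
          rintro ⟨t, ht⟩
          rw [← Submodule.eq_of_le_of_finrank_le hle hcon] at ht
          obtain ⟨u, hu, rfl⟩ := ht
          exact ⟨⟨u, hu⟩, rfl⟩
        have hinj := LinearMap.injective_iff_surjective.mpr hsurj
        have h0 : φ ⟨1, h1⟩ = 0 := by
          ext
          simp [φ, functionalAct_apply, hf, Algebra.TensorProduct.one_def]
        have := hinj (h0.trans φ.map_zero.symm)
        have h10 : (1 : H) = 0 := congrArg Subtype.val this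
        refine hbot (eq_bot_iff.mpr fun x _ ↦ ?_)
        rw [Submodule.mem_bot, ← one_mul x, h10, zero_mul]
      refine ih _ hlt _ inferInstance rfl ?_ ⟨d, hd, rfl⟩
      rintro g _ ⟨t, ht, rfl⟩
      rw [functionalAct_functionalAct, functionalMul_comm hcocomm,
        ← functionalAct_functionalAct]
      exact ⟨_, hT g t ht, rfl⟩
  refine eq_top_iff.mpr fun d _ ↦
    key _ (functionalOrbit (C := C) d) (finiteDimensional_functionalOrbit d) rfl ?_
      ⟨Coalgebra.counit, functionalAct_counit d⟩
  rintro f _ ⟨g, rfl⟩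
  exact ⟨functionalMul g f, (functionalAct_functionalAct f g d).symm⟩

section ModuleAlgebra

variable {C D1 D R : Type*} [Field C] [Ring D1] [Bialgebra C D1] [Ring D] [Bialgebra C D]
  [CommRing R] [Algebra C R]

lemma ModuleAlgebraStructure.act_mul_eq_conv (Ψ : ModuleAlgebraStructure C D R) (ι : D1 →ₐ[C] D)
    (hιco : ∀ x : D1, Coalgebra.comul (R := C) (ι x) =
      TensorProduct.map ι.toLinearMap ι.toLinearMap (Coalgebra.comul (R := C) x))
    (x : D1) (a b : R) : Ψ.act (ι x) (a * b) =
      conv C D1 (Ψ.act.flip a ∘ₗ ι.toLinearMap) (Ψ.act.flip b ∘ₗ ι.toLinearMap) x := by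
  rw [Ψ.measure_mul, conv, conv]
  simp only [LinearMap.comp_apply]
  rw [hιco, TensorProduct.map_comp, LinearMap.comp_apply]

lemma ModuleAlgebraStructure.act_grouplike_mul (Ψ : ModuleAlgebraStructure C D R) {g : D}
    (hg : Coalgebra.comul (R := C) g = g ⊗ₜ[C] g) (a b : R) :
    Ψ.act g (a * b) = Ψ.act g a * Ψ.act g b := by
  simp [Ψ.measure_mul, conv, hg]

/-- A grouplike element acts as a ring endomorphism. -/
noncomputable def ModuleAlgebraStructure.grouplikeRingHom (Ψ : ModuleAlgebraStructure C D R)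
    (g : D) (hg : Coalgebra.comul (R := C) g = g ⊗ₜ[C] g)
    (hg1 : Coalgebra.counit (R := C) g = 1) : R →+* R where
  toFun := Ψ.act g
  map_one' := by simp [Ψ.measure_one, hg1]
  map_mul' := Ψ.act_grouplike_mul hg
  map_zero' := map_zero _
  map_add' := map_add _

lemma mul'_map_mem_of_range_lTensor {H : Type*} [AddCommGroup H] [Module C H] (I : Ideal R)
    (u v : H →ₗ[C] R) (W : Submodule C H) (hv : ∀ d ∈ W, v d ∈ I) (t : H ⊗[C] H)
    (ht : t ∈ LinearMap.range (W.subtype.lTensor H)) :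
    LinearMap.mul' C R (TensorProduct.map u v t) ∈ I := by
  obtain ⟨t, rfl⟩ := ht
  induction t with
  | zero => simp
  | add x y hx hy => simpa only [map_add] using I.add_mem hx hy
  | tmul x w => simpa using I.mul_mem_left _ (hv _ w.2)

lemma mul'_map_mem (I : Ideal R) {H : Type*} [AddCommGroup H] [Module C H]
    (u v : H →ₗ[C] R) (hv : ∀ d, v d ∈ I) (t : H ⊗[C] H) :
    LinearMap.mul' C R (TensorProduct.map u v t) ∈ I := by
  refine mul'_map_mem_of_range_lTensor I u v ⊤ (fun d _ ↦ hv d) t ?_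
  have hsurj : Function.Surjective (⊤ : Submodule C H).subtype := fun x ↦ ⟨⟨x, trivial⟩, rfl⟩
  exact LinearMap.lTensor_surjective H hsurj t

/-- The kernel of a localization map is stable under an irreducible cocommutative bialgebra. -/
lemma ModuleAlgebraStructure.act_mem_of_smul_closed (Ψ : ModuleAlgebraStructure C D R)
    (ι : D1 →ₐ[C] D)
    (hιco : ∀ x : D1, Coalgebra.comul (R := C) (ι x) =
      TensorProduct.map ι.toLinearMap ι.toLinearMap (Coalgebra.comul (R := C) x))
    (hcocomm : (TensorProduct.comm C D1 D1).toLinearMap ∘ₗ Coalgebra.comul (R := C) =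
      Coalgebra.comul (R := C))
    (hirr : ∀ S : Submodule C D1, S ≠ ⊥ →
      (∀ s ∈ S, Coalgebra.comul (R := C) s ∈
        LinearMap.range (TensorProduct.map S.subtype S.subtype)) → (1 : D1) ∈ S)
    (I : Ideal R) {s b : R} (hs : ∀ r, s * r ∈ I → r ∈ I) (hsb : s * b = 0) (x : D1) :
    Ψ.act (ι x) b ∈ I := by
  let W : Submodule C D1 := (I.restrictScalars C).comap (Ψ.act.flip b ∘ₗ ι.toLinearMap)
  suffices hW : W = ⊤ by
    have : x ∈ W := hW ▸ trivial
    exact this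
  refine irreducible_induction hcocomm hirr W fun d hd ↦ ?_
  have ht : Coalgebra.comul (R := C) d - 1 ⊗ₜ[C] d ∈ LinearMap.range (W.subtype.lTensor D1) := by
    have hex : Function.Exact (W.subtype.lTensor D1) (W.mkQ.lTensor D1) :=
      lTensor_exact D1 (LinearMap.exact_subtype_mkQ W) W.mkQ_surjective
    refine (hex _).mp (TensorProduct.ext_of_dual_left fun f ↦ ?_)
    rw [TensorProduct.lid_rTensor_lTensor]
    have hf : TensorProduct.lid C D1 (f.rTensor D1 (Coalgebra.comul (R := C) d - 1 ⊗ₜ[C] d)) =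
        functionalAct (f + (-f 1) • Coalgebra.counit (R := C)) d := by
      rw [functionalAct_add, functionalAct_smul, functionalAct_counit, functionalAct_apply]
      simp [sub_eq_add_neg]
    rw [hf]
    simpa using hd _ (by simp)
  have h0 := Ψ.act_mul_eq_conv ι hιco d s b
  rw [hsb, map_zero] at h0
  have hmem := mul'_map_mem_of_range_lTensor I (Ψ.act.flip s ∘ₗ ι.toLinearMap)
    (Ψ.act.flip b ∘ₗ ι.toLinearMap) W (fun _ h ↦ h) _ ht
  rw [map_sub, map_sub] at hmem
  change _ = LinearMap.mul' C R (TensorProduct.map _ _ (Coalgebra.comul d)) at h0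
  rw [← h0] at hmem
  simp only [map_tmul, LinearMap.comp_apply, LinearMap.flip_apply, AlgHom.toLinearMap_apply,
    map_one, Ψ.act_one, LinearMap.id_apply, LinearMap.mul'_apply, zero_sub, neg_mem_iff] at hmem
  exact hs _ hmem

/-- The Birkhoff–Witt property makes every minimal prime with small residue ring stable. -/
lemma ModuleAlgebraStructure.act_mem_of_small_quotient (Ψ : ModuleAlgebraStructure C D R)
    (ι : D1 →ₐ[C] D)
    (hιco : ∀ x : D1, Coalgebra.comul (R := C) (ι x) =
      TensorProduct.map ι.toLinearMap ι.toLinearMap (Coalgebra.comul (R := C) x))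
    (hBW : ∀ (A : Type) [CommRing A] [IsDomain A] [Algebra C A] (f g : D1 →ₗ[C] A),
      conv C D1 f g = 0 → f = 0 ∨ g = 0)
    (P : Ideal R) (hP : P ∈ minimalPrimes R) [Small.{0} (R ⧸ P)] (x : D1) {a : R} (ha : a ∈ P) :
    Ψ.act (ι x) a ∈ P := by
  have : P.IsPrime := hP.1.1
  let Q : Ideal R :=
    { carrier := {a | ∀ d : D1, Ψ.act (ι d) a ∈ P}
      add_mem' := fun ha hb d ↦ by simpa using P.add_mem (ha d) (hb d)
      zero_mem' := fun d ↦ by simp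
      smul_mem' := fun c a ha d ↦ by
        rw [smul_eq_mul, Ψ.act_mul_eq_conv ι hιco]
        exact mul'_map_mem P _ (Ψ.act.flip a ∘ₗ ι.toLinearMap) ha _ }
  have hQP : Q ≤ P := fun a ha ↦ by simpa [Ψ.act_one] using ha 1
  let π : R →ₐ[C] Shrink.{0} (R ⧸ P) :=
    (Shrink.algEquiv C (R ⧸ P)).symm.toAlgHom.comp (Ideal.Quotient.mkₐ C P)
  have hπ : ∀ r, π r = 0 ↔ r ∈ P := fun r ↦ by
    rw [← Ideal.Quotient.eq_zero_iff_mem]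
    exact map_eq_zero_iff (Shrink.algEquiv C (R ⧸ P)).symm (AlgEquiv.injective _)
  have hQ : Q.IsPrime := by
    refine ⟨fun h ↦ this.ne_top (top_le_iff.mp (h ▸ hQP)), fun {a b} hab ↦ ?_⟩
    have hconv : conv C D1 (π.toLinearMap ∘ₗ Ψ.act.flip a ∘ₗ ι.toLinearMap)
        (π.toLinearMap ∘ₗ Ψ.act.flip b ∘ₗ ι.toLinearMap) = 0 := by
      refine LinearMap.ext fun d ↦ ?_
      have h := (hπ _).mpr (hab d)
      rw [Ψ.act_mul_eq_conv ι hιco] at h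
      rw [LinearMap.zero_apply, ← h]
      simp only [conv, LinearMap.comp_apply]
      induction Coalgebra.comul (R := C) d with
      | zero => simp
      | add u v hu hv => simp only [map_add, hu, hv]
      | tmul u v => simp
    exact (hBW _ _ _ hconv).imp (fun h d ↦ (hπ _).mp (LinearMap.congr_fun h d))
      (fun h d ↦ (hπ _).mp (LinearMap.congr_fun h d))
  exact hP.2 ⟨hQ, bot_le⟩ hQP ha x

end ModuleAlgebra

section CommRing

variable {R : Type*} [CommRing R]

lemma comap_mem_minimalPrimes_of_injective [IsNoetherianRing R] (f : R →+* R)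
    (hf : Function.Injective f) {P : Ideal R} (hP : P ∈ minimalPrimes R) :
    P.comap f ∈ minimalPrimes R := by
  have hfin := minimalPrimes.finite_of_isNoetherianRing R
  have hsub : minimalPrimes R ⊆ Ideal.comap f '' minimalPrimes R := fun p hp ↦ by
    refine Ideal.exists_minimalPrimes_comap_eq (I := ⊥) f p ?_
    rwa [← RingHom.ker_eq_comap_bot, (RingHom.injective_iff_ker_eq_bot f).mp hf]
  rw [Set.eq_of_subset_of_ncard_le hsub (Set.ncard_image_le hfin) (hfin.image _)]
  exact ⟨P, hP, rfl⟩

/-- The elements annihilated by some element outside all minimal primes. -/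
def torsionOutsideMinimalPrimes (R : Type*) [CommRing R] : Ideal R where
  carrier := {b | ∃ s : R, (∀ P ∈ minimalPrimes R, s ∉ P) ∧ s * b = 0}
  add_mem' := by
    rintro a b ⟨s, hs, hsa⟩ ⟨t, ht, htb⟩
    refine ⟨s * t, fun P hP h ↦ (hP.1.1.mem_or_mem h).elim (hs P hP) (ht P hP), ?_⟩
    linear_combination t * hsa + s * htb
  zero_mem' := ⟨1, fun P hP h ↦ hP.1.1.ne_top ((Ideal.eq_top_iff_one P).mpr h), by simp⟩
  smul_mem' := by
    rintro c a ⟨s, hs, hsa⟩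
    exact ⟨s, hs, by rw [smul_eq_mul]; linear_combination c * hsa⟩

lemma mem_torsionOutsideMinimalPrimes_of_mul_mem {s r : R} (hs : ∀ P ∈ minimalPrimes R, s ∉ P)
    (h : s * r ∈ torsionOutsideMinimalPrimes R) : r ∈ torsionOutsideMinimalPrimes R := by
  obtain ⟨t, ht, htr⟩ := h
  exact ⟨t * s, fun P hP h ↦ (hP.1.1.mem_or_mem h).elim (ht P hP) (hs P hP), by rw [← htr]; ring⟩

lemma torsionOutsideMinimalPrimes_ne_top [Nontrivial R] : torsionOutsideMinimalPrimes R ≠ ⊤ := by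
  rw [Ne, Ideal.eq_top_iff_one]
  rintro ⟨s, hs, hs1⟩
  obtain ⟨m, hm⟩ := Ideal.exists_maximal R
  obtain ⟨P, hP, -⟩ := Ideal.exists_minimalPrimes_le (bot_le : ⊥ ≤ m)
  exact hs P hP (by rw [← mul_one s, hs1]; exact P.zero_mem)

/-- A Noetherian ring without embedded primes which is its own total quotient ring has Krull
dimension at most zero. -/
lemma krullDimLE_zero_of_torsionOutsideMinimalPrimes_eq_bot [IsNoetherianRing R]
    (h : torsionOutsideMinimalPrimes R = ⊥) (hR : ∀ a ∈ nonZeroDivisors R, IsUnit a) :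
    Ring.KrullDimLE 0 R := by
  have hfin := minimalPrimes.finite_of_isNoetherianRing R
  rw [Ring.krullDimLE_zero_iff_forall_minimalPrimes_isMaximal]
  intro P hP
  obtain ⟨m, hm, hPm⟩ := Ideal.exists_le_maximal P hP.1.1.ne_top
  have hcover : (m : Set R) ⊆ ⋃ Q ∈ (hfin.toFinset : Set (Ideal R)), (Q : Set R) := by
    intro s hs
    by_contra hcon
    have hs' : ∀ Q ∈ minimalPrimes R, s ∉ Q := by simpa using hcon
    refine hm.ne_top (Ideal.eq_top_of_isUnit_mem m hs (hR s ?_))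
    rw [mem_nonZeroDivisors_iff_right]
    intro b hb
    have : b ∈ torsionOutsideMinimalPrimes R := ⟨s, hs', by rw [mul_comm, hb]⟩
    rwa [h] at this
  obtain ⟨Q, hQ, hmQ⟩ := (Ideal.subset_union_prime (f := fun Q : Ideal R ↦ Q) ⊥ ⊥
    fun Q hQ _ _ ↦ ((hfin.mem_toFinset).mp hQ).1.1).mp hcover
  rw [hfin.mem_toFinset] at hQ
  have hQP : Q ≤ P := hQ.2 hP.1 (hPm.trans hmQ)
  rwa [← le_antisymm hPm (hmQ.trans hQP)] at hm

lemma exists_isMaximal_small_quotient (M : Type) [AddCommGroup M] [Module R M] [Nontrivial M] :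
    ∃ P : Ideal R, P.IsMaximal ∧ Small.{0} (R ⧸ P) := by
  obtain ⟨m, hm⟩ := exists_ne (0 : M)
  have hne : LinearMap.ker (LinearMap.toSpanSingleton R M m) ≠ ⊤ := fun h ↦ hm <| by
    have : (1 : R) ∈ LinearMap.ker (LinearMap.toSpanSingleton R M m) := h ▸ trivial
    simpa using this
  obtain ⟨P, hP, hle⟩ := Ideal.exists_le_maximal _ hne
  have : Small.{0} (R ⧸ LinearMap.ker (LinearMap.toSpanSingleton R M m)) :=
    small_of_injective (LinearMap.quotKerEquivRange _).injective
  exact ⟨P, hP, small_of_surjective (Ideal.Quotient.factor_surjective hle)⟩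

end CommRing

section Smash

variable {C D1 D G R : Type*} [Field C] [Ring D1] [Bialgebra C D1] [Ring D] [Bialgebra C D]
  [CommMonoid G] [CommRing R] [Algebra C R]

lemma ModuleAlgebraStructure.stable_of_span (Ψ : ModuleAlgebraStructure C D R)
    (ι : D1 →ₐ[C] D) (gl : G →* D)
    (hspan : Submodule.span C {d : D | ∃ (x : D1) (g : G), d = ι x * gl g} = ⊤)
    (I : Ideal R) (h1 : ∀ x : D1, ∀ a ∈ I, Ψ.act (ι x) a ∈ I)
    (hG : ∀ g : G, ∀ a ∈ I, Ψ.act (gl g) a ∈ I) (d : D) (a : R) (ha : a ∈ I) :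
    Ψ.act d a ∈ I := by
  have hle : Submodule.span C {d : D | ∃ (x : D1) (g : G), d = ι x * gl g} ≤
      (I.restrictScalars C).comap (Ψ.act.flip a) := by
    rw [Submodule.span_le]
    rintro _ ⟨x, g, rfl⟩
    change Ψ.act (ι x * gl g) a ∈ I
    rw [Ψ.act_mul]
    exact h1 x _ (hG g a ha)
  exact hle (hspan ▸ trivial : d ∈ _)

end Smash

/-- with `D = D¹ # CG` as in the previous statement and `R` a Noetherian
simple commutative `D`-module algebra on which each `g ∈ G` acts injectively, the
following are equivalent: (1) `R` is total (every non-zero-divisor is a unit);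
(2) `R/P` is a field for every minimal prime `P`; (3) the Krull dimension of `R` is zero;
(4) `R` is Artinian as a ring.  In this case every `R`-module is projective. -/
theorem noetherian_simple_module_algebra_artinian_tfae
    (C D1 D G R : Type*) [Field C] [Ring D1] [Bialgebra C D1] [Ring D] [Bialgebra C D]
    [CommMonoid G]
    -- `D¹` is cocommutative
    (hcocomm : (TensorProduct.comm C D1 D1).toLinearMap ∘ₗ Coalgebra.comul (R := C) =
      Coalgebra.comul (R := C))
    -- `D¹` is pointed irreducible
    (hirr : ∀ S : Submodule C D1, S ≠ ⊥ →
      (∀ s ∈ S, Coalgebra.comul (R := C) s ∈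
        LinearMap.range (TensorProduct.map S.subtype S.subtype)) → (1 : D1) ∈ S)
    -- `D¹` is of Birkhoff–Witt type
    (hBW : ∀ (A : Type) [CommRing A] [IsDomain A] [Algebra C A] (f g : D1 →ₗ[C] A),
      conv C D1 f g = 0 → f = 0 ∨ g = 0)
    -- `D¹` embeds in `D` as a sub-bialgebra
    (ι : D1 →ₐ[C] D)
    (hι : Function.Injective ι)
    (hιco : ∀ x : D1, Coalgebra.comul (R := C) (ι x) =
      TensorProduct.map ι.toLinearMap ι.toLinearMap (Coalgebra.comul (R := C) x))
    (hιcounit : ∀ x : D1, Coalgebra.counit (R := C) (ι x) = Coalgebra.counit (R := C) x)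
    -- `G` embeds in `D` as grouplike elements
    (gl : G →* D)
    (hgrouplike : ∀ g : G, Coalgebra.comul (R := C) (gl g) = gl g ⊗ₜ[C] gl g ∧
      Coalgebra.counit (R := C) (gl g) = 1)
    -- smash product relations: `(1#g)(x#1) = (g.x)#g` and `D = D¹ · CG`
    (hsmash : ∀ (g : G) (x : D1), ∃ y : D1, gl g * ι x = ι y * gl g)
    (hspan : Submodule.span C {d : D | ∃ (x : D1) (g : G), d = ι x * gl g} = ⊤)
    -- `R` is a Noetherian simple commutative `D`-module algebra with injective `G`-action
    [CommRing R] [Algebra C R] [IsNoetherianRing R] [Nontrivial R]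
    (ΨR : ModuleAlgebraStructure C D R)
    (hsimple : ∀ I : Ideal R, (∀ (d : D), ∀ a ∈ I, ΨR.act d a ∈ I) → I = ⊥ ∨ I = ⊤)
    (hinj : ∀ g : G, Function.Injective (ΨR.act (gl g))) :
    ((∀ a ∈ nonZeroDivisors R, IsUnit a) ↔
      (∀ P ∈ minimalPrimes R, IsField (R ⧸ P))) ∧
    ((∀ P ∈ minimalPrimes R, IsField (R ⧸ P)) ↔ ringKrullDim R = 0) ∧
    (ringKrullDim R = 0 ↔ IsArtinianRing R) ∧
    ((∀ a ∈ nonZeroDivisors R, IsUnit a) →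
      ∀ (M : Type) [AddCommGroup M] [Module R M], Module.Projective R M) := by
  have hcomul g := (hgrouplike g).1
  have hcounit g := (hgrouplike g).2
  let φ : G → (R →+* R) := fun g ↦ ΨR.grouplikeRingHom (gl g) (hcomul g) (hcounit g)
  have htorsion : torsionOutsideMinimalPrimes R = ⊥ := by
    refine (hsimple _ (ΨR.stable_of_span ι gl hspan _ ?_ ?_)).resolve_right
      torsionOutsideMinimalPrimes_ne_top
    · rintro x b ⟨s, hs, hsb⟩
      exact ΨR.act_mem_of_smul_closed ι hιco hcocomm hirr _
        (fun r ↦ mem_torsionOutsideMinimalPrimes_of_mul_mem hs) hsb x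
    · rintro g b ⟨s, hs, hsb⟩
      refine ⟨ΨR.act (gl g) s, fun P hP hsP ↦ hs _
        (comap_mem_minimalPrimes_of_injective (φ g) (hinj g) hP) hsP, ?_⟩
      rw [← ΨR.act_grouplike_mul (hcomul g), hsb, map_zero]
  have h12 : (∀ a ∈ nonZeroDivisors R, IsUnit a) → Ring.KrullDimLE 0 R :=
    krullDimLE_zero_of_torsionOutsideMinimalPrimes_eq_bot htorsion
  have hfield : (∀ P ∈ minimalPrimes R, IsField (R ⧸ P)) ↔ Ring.KrullDimLE 0 R := by
    simp_rw [Ring.krullDimLE_zero_iff_forall_minimalPrimes_isMaximal,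
      Ideal.Quotient.maximal_ideal_iff_isField_quotient]
  refine ⟨⟨fun h ↦ hfield.mpr (h12 h), fun h a ha ↦ ?_⟩,
    hfield.trans ringKrullDimZero_iff_ringKrullDim_eq_zero,
    ringKrullDimZero_iff_ringKrullDim_eq_zero.symm.trans
      isArtinianRing_iff_krullDimLE_zero.symm, fun h M _ _ ↦ ?_⟩
  · have := isArtinianRing_iff_krullDimLE_zero.mpr (hfield.mp h)
    exact IsArtinianRing.isUnit_of_mem_nonZeroDivisors ha
  · have hdim := h12 h
    rcases subsingleton_or_nontrivial M with hM | hM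
    · infer_instance
    obtain ⟨P₀, hP₀, hsmall⟩ := exists_isMaximal_small_quotient (R := R) M
    have hK : sInf {P : Ideal R | P.IsPrime ∧ Small.{0} (R ⧸ P)} = ⊥ := by
      refine (hsimple _ (ΨR.stable_of_span ι gl hspan _ ?_ ?_)).resolve_right fun htop ↦
        hP₀.ne_top (top_le_iff.mp (htop ▸ sInf_le ⟨hP₀.isPrime, hsmall⟩))
      · intro x a ha
        rw [Ideal.mem_sInf] at ha ⊢
        rintro P ⟨hP, hPs⟩
        exact ΨR.act_mem_of_small_quotient ι hιco hBW P
          (Ideal.mem_minimalPrimes_iff_isPrime.mpr hP) x (ha ⟨hP, hPs⟩)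
      · intro g a ha
        rw [Ideal.mem_sInf] at ha ⊢
        rintro P ⟨hP, hPs⟩
        exact ha (I := P.comap (φ g)) ⟨hP.comap (φ g),
          small_of_injective (Ideal.quotientMap_injective (f := φ g) (I := P))⟩
    have : IsReduced R := by
      refine ⟨fun a ha ↦ ?_⟩
      rw [← Ideal.mem_bot, ← hK, Ideal.mem_sInf]
      rintro P ⟨hP, -⟩
      obtain ⟨n, hn⟩ := ha
      exact hP.mem_of_pow_mem n (hn ▸ P.zero_mem)
    have := isArtinianRing_iff_krullDimLE_zero.mpr hdim
    have := IsArtinianRing.isSemisimpleRing_of_isReduced R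
    exact Module.projective_of_isSemisimpleRing R M
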